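/- arXiv:1811.10096 — 3 statements merged into one kernel-verified Lean document; each statement's English description precedes it below -/
import Mathlib

section
/- Let X be a metric space and let p : X → ℝ₊ be a coarse map. Then the flip map F : I_pX → I_pX defined by F(x, t) = (x, p(x) + 1 − t) is a coarse map. -/
open scoped NNReal

/-- A map between metric spaces is controlled if points at distance `≤ R`
are mapped to points at distance `≤ S = S(R)`. -/
def Controlled {X Y : Type*} [PseudoMetricSpace X] [PseudoMetricSpace Y] (f : X → Y) : Prop :=
  ∀ R : ℝ, 0 < R → ∃ S : ℝ, 0 < S ∧ ∀ x y : X, dist x y ≤ R → dist (f x) (f y) ≤ S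

/-- A map between metric spaces is coarse if it is controlled and preimages
of bounded sets are bounded. -/
def IsCoarseMap {X Y : Type*} [PseudoMetricSpace X] [PseudoMetricSpace Y] (f : X → Y) : Prop :=
  Controlled f ∧ ∀ B : Set Y, Bornology.IsBounded B → Bornology.IsBounded (f ⁻¹' B)

/-- The `p`-cylinder `I_pX = {(x,t) ∈ X × ℝ₊ : t ≤ p x + 1}`; as a subset of the
product `X × ℝ₊` it carries the sup metric `max (dist x y) |s - t|`. -/
def cylSet {X : Type*} (p : X → ℝ≥0) : Set (X × ℝ≥0) :=
  {z | z.2 ≤ p z.1 + 1}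

/-- A controlled map sends bounded sets to bounded sets. -/
theorem Controlled.isBounded_image {X Y : Type*} [PseudoMetricSpace X] [PseudoMetricSpace Y]
    {f : X → Y} (hf : Controlled f) {B : Set X} (hB : Bornology.IsBounded B) :
    Bornology.IsBounded (f '' B) := by
  obtain ⟨C, hC⟩ := Metric.isBounded_iff.1 hB
  obtain ⟨S, -, hS⟩ := hf (max C 1) (lt_max_of_lt_right one_pos)
  refine Metric.isBounded_iff.2 ⟨S, ?_⟩
  rintro _ ⟨x, hx, rfl⟩ _ ⟨y, hy, rfl⟩
  exact hS x y ((hC hx hy).trans (le_max_left _ _))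

/-- A controlled involution is coarse. -/
theorem Controlled.isCoarseMap_of_involutive {X : Type*} [PseudoMetricSpace X] {f : X → X}
    (hf : Controlled f) (hinv : Function.Involutive f) : IsCoarseMap f := by
  refine ⟨hf, fun B hB => ?_⟩
  rw [← hinv.image_eq_preimage_symm]
  exact hf.isBounded_image hB

/-- The flip map `F : I_pX → I_pX`, `F (x, t) = (x, p x + 1 - t)`, is coarse. -/
theorem flip_map_coarse {X : Type*} [PseudoMetricSpace X]
    (p : X → ℝ≥0) (hp : IsCoarseMap p) :
    IsCoarseMap (fun z : cylSet p =>
      (⟨(z.1.1, p z.1.1 + 1 - z.1.2), by simp [cylSet]⟩ : cylSet p)) := by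
  refine Controlled.isCoarseMap_of_involutive (fun R hR => ?_) ?_
  · obtain ⟨S, hS, h⟩ := hp.1 R hR
    refine ⟨S + R, add_pos hS hR, ?_⟩
    rintro ⟨⟨x, s⟩, hs⟩ ⟨⟨y, t⟩, ht⟩ hd
    simp only [cylSet, Set.mem_ofPred_eq] at hs ht
    simp only [Subtype.dist_eq, Prod.dist_eq, max_le_iff] at hd ⊢
    have hxy := h x y hd.1
    have hst := hd.2
    refine ⟨by linarith [hd.1], ?_⟩
    rw [NNReal.dist_eq, abs_le] at hxy hst ⊢
    rw [NNReal.coe_sub hs, NNReal.coe_sub ht]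
    push_cast
    constructor <;> linarith
  · rintro ⟨⟨x, t⟩, ht⟩
    exact Subtype.ext (Prod.ext rfl (tsub_tsub_cancel_of_le ht))
end

section
/- Let X and Y be metric spaces, let p : X → ℝ₊ be any coarse map, and let f₀, f₁ : X → Y be close coarse maps. Then the map H : I_pX → Y defined by H(x,t) = f₀(x) for t < 1 and H(x,t) = f₁(x) for t ≥ 1 is a coarse homotopy between f₀ and f₁; in particular, close coarse maps are coarsely homotopic. -/
open scoped NNReal

/-- Two coarse maps `f₀ f₁ : X → Y` are coarsely homotopic if there is a coarse map
`p : X → ℝ₊` and a coarse map `H : I_pX → Y` with `H ∘ i₀ = f₀` and `H ∘ i₁ = f₁`. -/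
def CoarseHomotopic {X Y : Type*} [PseudoMetricSpace X] [PseudoMetricSpace Y]
    (f₀ f₁ : X → Y) : Prop :=
  ∃ p : X → ℝ≥0, IsCoarseMap p ∧ ∃ H : cylSet p → Y, IsCoarseMap H ∧
    (∀ x : X, H ⟨(x, 0), by simp [cylSet]⟩ = f₀ x) ∧
    (∀ x : X, H ⟨(x, p x + 1), by simp [cylSet]⟩ = f₁ x)

/-- The piecewise homotopy `H(x,t) = f₀ x` for `t < 1` and `H(x,t) = f₁ x` for `t ≥ 1`. -/
noncomputable def pieceHomotopy {X Y : Type*} (p : X → ℝ≥0) (f₀ f₁ : X → Y)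
    (z : cylSet p) : Y :=
  if z.1.2 < 1 then f₀ z.1.1 else f₁ z.1.1

/-- The cylinder projection `I_pX → X` pulls bounded sets back to bounded sets
whenever `p` is controlled. -/
theorem isBounded_cylSet_preimage_fst {X : Type*} [PseudoMetricSpace X] {p : X → ℝ≥0}
    (hp : Controlled p) {A : Set X} (hA : Bornology.IsBounded A) :
    Bornology.IsBounded ((fun z : cylSet p => z.1.1) ⁻¹' A) := by
  have hpA : Bornology.IsBounded (p '' A) := by
    obtain ⟨C, hC⟩ := Metric.isBounded_iff.1 hA
    obtain ⟨S, -, hS⟩ := hp (max C 1) (by positivity)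
    refine Metric.isBounded_iff.2 ⟨S, ?_⟩
    rintro _ ⟨x, hx, rfl⟩ _ ⟨y, hy, rfl⟩
    exact hS x y ((hC hx hy).trans (le_max_left _ _))
  obtain ⟨M, hM⟩ := hpA.bddAbove
  have hprod : Bornology.IsBounded (A ×ˢ Set.Icc (0 : ℝ≥0) (M + 1)) :=
    hA.prod (Metric.isBounded_Icc _ _)
  obtain ⟨C, hC⟩ := Metric.isBounded_iff.1 hprod
  have mem_prod : ∀ z : cylSet p, z.1.1 ∈ A → z.1 ∈ A ×ˢ Set.Icc (0 : ℝ≥0) (M + 1) :=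
    fun z hz => ⟨hz, zero_le, z.2.trans (add_le_add_left (hM ⟨_, hz, rfl⟩) 1)⟩
  exact Metric.isBounded_iff.2 ⟨C, fun z hz w hw => hC (mem_prod z hz) (mem_prod w hw)⟩

/-- A map close to a controlled map is controlled. -/
theorem Controlled.of_dist_le {X Y : Type*} [PseudoMetricSpace X] [PseudoMetricSpace Y]
    {f g : X → Y} (hf : Controlled f) {K : ℝ} (hK : ∀ x, dist (f x) (g x) ≤ K) :
    Controlled g := by
  intro R hR
  obtain ⟨S, hS, h⟩ := hf R hR
  refine ⟨S + 2 * |K|, by positivity, fun x y hxy => ?_⟩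
  have htri := dist_triangle4 (g x) (f x) (f y) (g y)
  linarith [h x y hxy, hK x, hK y, le_abs_self K, dist_comm (f x) (g x)]

theorem isCoarseMap_pieceHomotopy {X Y : Type*} [PseudoMetricSpace X] [PseudoMetricSpace Y]
    {p : X → ℝ≥0} (hp : Controlled p) {f₀ f₁ : X → Y}
    (hf₀ : IsCoarseMap f₀) (hf₁ : IsCoarseMap f₁)
    (hclose : ∃ K : ℝ, ∀ x : X, dist (f₀ x) (f₁ x) ≤ K) :
    IsCoarseMap (pieceHomotopy p f₀ f₁) := by
  obtain ⟨K, hK⟩ := hclose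
  constructor
  · have hfst : Controlled (fun z : cylSet p => f₀ z.1.1) := by
      intro R hR
      obtain ⟨S, hS, h⟩ := hf₀.1 R hR
      exact ⟨S, hS, fun z w hzw => h _ _ ((le_max_left _ _).trans hzw)⟩
    refine hfst.of_dist_le (K := |K|) fun z => ?_
    unfold pieceHomotopy
    split_ifs
    · simp
    · exact (hK _).trans (le_abs_self K)
  · intro B hB
    refine (isBounded_cylSet_preimage_fst hp ((hf₀.2 B hB).union (hf₁.2 B hB))).subset ?_
    intro z hz
    simp only [Set.mem_preimage, pieceHomotopy] at hz
    split_ifs at hz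
    · exact Or.inl hz
    · exact Or.inr hz

/-- Close coarse maps are coarsely homotopic, via the piecewise homotopy. -/
theorem close_maps_coarsely_homotopic {X Y : Type*}
    [PseudoMetricSpace X] [PseudoMetricSpace Y]
    (p : X → ℝ≥0) (hp : IsCoarseMap p) (f₀ f₁ : X → Y)
    (hf₀ : IsCoarseMap f₀) (hf₁ : IsCoarseMap f₁)
    (hclose : ∃ K : ℝ, ∀ x : X, dist (f₀ x) (f₁ x) ≤ K) :
    IsCoarseMap (pieceHomotopy p f₀ f₁) ∧
    (∀ x : X, pieceHomotopy p f₀ f₁ ⟨(x, 0), by simp [cylSet]⟩ = f₀ x) ∧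
    (∀ x : X, pieceHomotopy p f₀ f₁ ⟨(x, p x + 1), by simp [cylSet]⟩ = f₁ x) ∧
    CoarseHomotopic f₀ f₁ := by
  have hH := isCoarseMap_pieceHomotopy hp.1 hf₀ hf₁ hclose
  have h₀ : ∀ x : X, pieceHomotopy p f₀ f₁ ⟨(x, 0), by simp [cylSet]⟩ = f₀ x := by
    simp [pieceHomotopy]
  have h₁ : ∀ x : X, pieceHomotopy p f₀ f₁ ⟨(x, p x + 1), by simp [cylSet]⟩ = f₁ x := by
    simp [pieceHomotopy]
  exact ⟨hH, h₀, h₁, p, hp, _, hH, h₀, h₁⟩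
end

section
/- Let X be a geodesic metric space, let x₀ ∈ X, and let p₀ : X → ℝ₊ be defined by p₀(x) = dist(x, x₀). Let Y be a metric space, let q : X → ℝ₊ be any coarse map, and suppose H : I_qX → Y is a coarse homotopy between coarse maps f, g : X → Y. Then there exists a coarse homotopy H̄ : I_{p₀}X → Y between f and g. -/
open scoped NNReal

/-- A metric space is geodesic if any two points `x, y` are joined by a path
`γ : [0, dist x y] → X` with `γ 0 = x`, `γ (dist x y) = y` and
`dist (γ s) (γ t) = |s - t|`. -/
def IsGeodesicSpace (X : Type*) [PseudoMetricSpace X] : Prop :=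
  ∀ x y : X, ∃ γ : ℝ → X, γ 0 = x ∧ γ (dist x y) = y ∧
    ∀ s ∈ Set.Icc (0 : ℝ) (dist x y), ∀ t ∈ Set.Icc (0 : ℝ) (dist x y),
      dist (γ s) (γ t) = |s - t|

theorem IsCoarseMap.comp {X Y Z : Type*} [PseudoMetricSpace X] [PseudoMetricSpace Y]
    [PseudoMetricSpace Z] {f : X → Y} {g : Y → Z} (hg : IsCoarseMap g) (hf : IsCoarseMap f) :
    IsCoarseMap (g ∘ f) := by
  refine ⟨fun R hR => ?_, fun B hB => hf.2 _ (hg.2 B hB)⟩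
  obtain ⟨S, hS, hfS⟩ := hf.1 R hR
  obtain ⟨T, hT, hgT⟩ := hg.1 S hS
  exact ⟨T, hT, fun x y h => hgT _ _ (hfS x y h)⟩

/-- A controlled function on a geodesic space grows at most linearly. -/
theorem Controlled.exists_le_mul_dist_add_one {X : Type*} [PseudoMetricSpace X]
    (hX : IsGeodesicSpace X) {q : X → ℝ≥0} (hq : Controlled q) (x₀ : X) :
    ∃ K : ℝ≥0, ∀ x, q x + 1 ≤ K * (nndist x x₀ + 1) := by
  obtain ⟨S, hS, hqS⟩ := hq 1 one_pos
  have step : ∀ x y : X, dist x y ≤ 1 → (q x : ℝ) ≤ q y + S := fun x y h => by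
    have h' := hqS x y h
    rw [NNReal.dist_eq] at h'
    linarith [le_abs_self ((q x : ℝ) - q y)]
  have key : ∀ n : ℕ, ∀ x : X, dist x x₀ ≤ n + 1 → (q x : ℝ) ≤ q x₀ + (n + 1) * S := by
    intro n
    induction n with
    | zero =>
      intro x hx
      have := step x x₀ (by simpa using hx)
      simpa using this
    | succ n ih =>
      intro x hx
      push_cast at hx ⊢
      rcases le_total (dist x x₀) 1 with h | h
      · have := step x x₀ h
        nlinarith [mul_nonneg (Nat.cast_nonneg (α := ℝ) n) hS.le]
      · obtain ⟨γ, h0, h1, hγ⟩ := hX x x₀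
        have hd₁ := hγ 0 ⟨le_rfl, dist_nonneg⟩ 1 ⟨zero_le_one, h⟩
        have hd₂ := hγ 1 ⟨zero_le_one, h⟩ _ ⟨dist_nonneg, le_rfl⟩
        rw [h0] at hd₁
        rw [h1, abs_sub_comm, abs_of_nonneg (by linarith)] at hd₂
        have hq₁ := step x (γ 1) (by rw [hd₁]; norm_num)
        have hq₂ := ih (γ 1) (by linarith)
        linarith
  refine ⟨q x₀ + 1 + S.toNNReal, fun x => ?_⟩
  rw [← NNReal.coe_le_coe]
  have hx := key ⌊dist x x₀⌋₊ x (Nat.lt_floor_add_one _).le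
  have hn := Nat.floor_le (dist_nonneg (x := x) (y := x₀))
  push_cast
  rw [Real.coe_toNNReal _ hS.le]
  have hd : 0 ≤ dist x x₀ := dist_nonneg
  nlinarith [mul_le_mul_of_nonneg_right hn hS.le, mul_nonneg (q x₀).2 hd]

/-- The vertical rescaling `(x, t) ↦ (x, min (q x + 1) (K * t))` from the `p`-cylinder to the
`q`-cylinder. -/
def cylRescale {X : Type*} (p q : X → ℝ≥0) (K : ℝ≥0) (z : cylSet p) : cylSet q :=
  ⟨(z.1.1, min (q z.1.1 + 1) (K * z.1.2)),
    min_le_left (q z.1.1 + 1) (K * z.1.2)⟩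

theorem isCoarseMap_cylRescale {X : Type*} [PseudoMetricSpace X] {p q : X → ℝ≥0}
    (hp : Controlled p) (hq : Controlled q) (K : ℝ≥0) : IsCoarseMap (cylRescale p q K) := by
  constructor
  · intro R hR
    obtain ⟨S, hS, hqS⟩ := hq R hR
    refine ⟨max R (max S (K * R)), lt_max_of_lt_left hR, ?_⟩
    rintro ⟨⟨x, s⟩, hs⟩ ⟨⟨y, t⟩, ht⟩ h
    rw [Subtype.dist_eq, Prod.dist_eq, max_le_iff] at h
    obtain ⟨hxy, hst⟩ := h
    rw [Subtype.dist_eq, Prod.dist_eq]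
    refine max_le_max hxy ?_
    have hqxy := hqS x y hxy
    simp only [cylRescale, NNReal.dist_eq, NNReal.coe_min] at hst hqxy ⊢
    refine (abs_min_sub_min_le_max _ _ _ _).trans (max_le_max ?_ ?_)
    · push_cast
      rwa [add_sub_add_right_eq_sub]
    · push_cast
      rw [← mul_sub, abs_mul, abs_of_nonneg (NNReal.coe_nonneg K)]
      exact mul_le_mul_of_nonneg_left hst K.2
  · intro B hB
    obtain ⟨C, hC⟩ := Metric.isBounded_iff.1 hB
    obtain ⟨S, hS, hpS⟩ := hp (max C 1) (by positivity)
    rcases (cylRescale p q K ⁻¹' B).eq_empty_or_nonempty with he | ⟨z, hz⟩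
    · simp [he]
    refine (Metric.isBounded_iff_subset_closedBall z).2 ⟨max C (p z.1.1 + S + 1), ?_⟩
    intro w hw
    have hx : dist w.1.1 z.1.1 ≤ C := (le_max_left _ _).trans (hC hw hz : max _ _ ≤ C)
    have hpw := hpS _ _ (hx.trans (le_max_left _ _))
    rw [Metric.mem_closedBall, Subtype.dist_eq, Prod.dist_eq]
    refine max_le_max hx ?_
    have hw₁ : (w.1.2 : ℝ) ≤ p w.1.1 + 1 := by exact_mod_cast w.2
    have hz₁ : (z.1.2 : ℝ) ≤ p z.1.1 + 1 := by exact_mod_cast z.2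
    rw [NNReal.dist_eq] at hpw ⊢
    have := abs_le.1 hpw
    rw [abs_le]
    constructor <;> linarith [NNReal.coe_nonneg w.1.2, NNReal.coe_nonneg z.1.2]

theorem controlled_nndist {X : Type*} [PseudoMetricSpace X] (x₀ : X) :
    Controlled (fun x => nndist x x₀) := fun R hR =>
  ⟨R, hR, fun x y h => by
    rw [NNReal.dist_eq, coe_nndist, coe_nndist]
    exact (abs_dist_sub_le x y x₀).trans h⟩

/-- A coarse homotopy on the cylinder of any coarse map `q : X → ℝ₊` can be
replaced by a coarse homotopy on the cylinder of the standard basepoint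
projection `p₀ x = dist x x₀`. -/
theorem coarse_homotopy_normalize {X Y : Type*} [MetricSpace X] [MetricSpace Y]
    (hX : IsGeodesicSpace X) (x₀ : X)
    (q : X → ℝ≥0) (hq : IsCoarseMap q)
    (f g : X → Y) (hf : IsCoarseMap f) (hg : IsCoarseMap g)
    (H : cylSet q → Y) (hH : IsCoarseMap H)
    (hH0 : ∀ x : X, H ⟨(x, 0), by simp [cylSet]⟩ = f x)
    (hH1 : ∀ x : X, H ⟨(x, q x + 1), by simp [cylSet]⟩ = g x) :
    ∃ H' : cylSet (fun x => nndist x x₀) → Y, IsCoarseMap H' ∧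
      (∀ x : X, H' ⟨(x, 0), by simp [cylSet]⟩ = f x) ∧
      (∀ x : X, H' ⟨(x, nndist x x₀ + 1), by simp [cylSet]⟩ = g x) := by
  obtain ⟨K, hK⟩ := hq.1.exists_le_mul_dist_add_one hX x₀
  refine ⟨H ∘ cylRescale _ q K, hH.comp (isCoarseMap_cylRescale (controlled_nndist x₀) hq.1 K),
    fun x => ?_, fun x => ?_⟩
  · rw [← hH0 x]
    simp [cylRescale]
  · rw [← hH1 x]
    simp [cylRescale, hK x]
end
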